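/- Let (V, b) be a finite-dimensional symplectic vector space over an algebraically closed field K of characteristic 2 and let e ∈ sp(V) be nilpotent, such that V is a direct sum of pairwise b-orthogonal nondegenerate e-invariant subspaces isomorphic (via isometries intertwining the nilpotent maps) to the nilpotent models W(m_1), …, W(m_t), W_{k_1}(ℓ_1), …, W_{k_{t'}}(ℓ_{t'}), V(2d_1), …, V(2d_{t''}), with t, t', t'' ≥ 0 and t + t' + t'' ≥ 1. Let α ≥ 0 be the largest integer such that 2^α divides every m_i, every ℓ_j, and every 2d_r. Consider the adjoint action ad(e) : X ↦ eX − Xe on the Lie algebra sp(V) and the induced action on the quotient sp(V)/Z(sp(V)). Then for every integer d ≥ 1 the multiplicities of Jordan blocks of size d of ad(e) on sp(V) and on sp(V)/Z(sp(V)) coincide, with the following exceptions: sp(V) has exactly one more Jordan block of size 2^α than sp(V)/Z(sp(V)), and, if α > 0, sp(V)/Z(sp(V)) has exactly one more Jordan block of size 2^α − 1 than sp(V). -/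

import Mathlib

/-- The symplectic Lie algebra `sp(V)` of a bilinear form `b`:
all `X` with `b(Xv, w) + b(v, Xw) = 0`, as a submodule of `End(V)`. -/
def spSub (K V : Type*) [Field K] [AddCommGroup V] [Module K V]
    (b : V →ₗ[K] V →ₗ[K] K) : Submodule K (Module.End K V) where
  carrier := {X | ∀ v w : V, b (X v) w + b v (X w) = 0}
  add_mem' := by
    intro X Y hX hY v w
    have h1 := hX v w
    have h2 := hY v w
    simp only [LinearMap.add_apply, map_add] at *
    linear_combination h1 + h2
  zero_mem' := by
    intro v w
    simp
  smul_mem' := by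
    intro c X hX v w
    have h := hX v w
    simp only [LinearMap.smul_apply, map_smul, smul_eq_mul] at *
    linear_combination c * h

/-- For a (nilpotent) endomorphism `N` of a finite-dimensional space, the multiplicity of
Jordan blocks of size `d ≥ 1` is `rank N^(d-1) - 2 * rank N^d + rank N^(d+1)`. -/
noncomputable def blockMult {K M : Type*} [Field K] [AddCommGroup M] [Module K M]
    (N : Module.End K M) (d : ℕ) : ℤ :=
  (Module.finrank K ↥(LinearMap.range (N ^ (d - 1))) : ℤ)
    - 2 * (Module.finrank K ↥(LinearMap.range (N ^ d)) : ℤ)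
    + (Module.finrank K ↥(LinearMap.range (N ^ (d + 1))) : ℤ)


section ringpart

variable {R : Type*} [Ring R]

lemma aux_pow2 (h2 : (2 : R) = 0) (x y : R) (h : Commute x y) (n : ℕ) :
    (x - y) ^ (2 ^ n) = x ^ (2 ^ n) + y ^ (2 ^ n) := by
  have hs : ∀ a : R, a + a = 0 := fun a => by rw [← two_mul, h2, zero_mul]
  induction n with
  | zero => simpa [sub_eq_add_neg] using (neg_eq_of_add_eq_zero_left (hs y))
  | succ n ih =>
    have hc : Commute (x ^ (2 ^ n)) (y ^ (2 ^ n)) := h.pow_pow _ _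
    rw [pow_succ 2 n, pow_mul, ih, hc.add_sq, pow_mul, pow_mul, h2]
    simp

lemma aux_geom (h2 : (2 : R) = 0) (x y : R) (h : Commute x y) (n : ℕ) :
    (x - y) ^ (2 ^ n - 1) = ∑ i ∈ Finset.range (2 ^ n), x ^ i * y ^ (2 ^ n - 1 - i) := by
  induction n with
  | zero => simp
  | succ n ih =>
    have hq : 0 < 2 ^ n := by positivity
    have e1 : 2 ^ (n + 1) - 1 = (2 ^ n) + (2 ^ n - 1) := by rw [pow_succ]; omega
    have e2 : 2 ^ (n + 1) = 2 ^ n + 2 ^ n := by rw [pow_succ]; omega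
    rw [e1, pow_add, ih, aux_pow2 h2 x y h, e2, Finset.sum_range_add, add_mul, add_comm,
      Finset.mul_sum, Finset.mul_sum]
    congr 1
    · refine Finset.sum_congr rfl fun i hi => ?_
      have hi := Finset.mem_range.1 hi
      rw [← mul_assoc, ((h.pow_pow i (2 ^ n)).eq).symm, mul_assoc, ← pow_add]
      congr 2; omega
    · refine Finset.sum_congr rfl fun i hi => ?_
      have hi := Finset.mem_range.1 hi
      rw [← mul_assoc, ← pow_add]
      congr 2; omega

end ringpart

lemma aux_sum_mul {M : Type*} [AddCommMonoid M] (f : ℕ → M) (q T : ℕ) :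
    ∑ t ∈ Finset.range T, ∑ i ∈ Finset.range q, f (q * t + i) = ∑ j ∈ Finset.range (q * T), f j := by
  induction T with
  | zero => simp
  | succ T ih => rw [Finset.sum_range_succ, ih, mul_add, mul_one, Finset.sum_range_add]

section rankpart

variable {K M : Type*} [Field K] [AddCommGroup M] [Module K M] [FiniteDimensional K M]

lemma aux_rank (z : M) (hz : z ≠ 0) (A : Module.End K M)
    (B : Module.End K (M ⧸ Submodule.span K {z}))
    (hB : ∀ X, B (Submodule.Quotient.mk X) = Submodule.Quotient.mk (A X)) (n : ℕ) :
    (Module.finrank K (LinearMap.range (A ^ n)) : ℤ) =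
      Module.finrank K (LinearMap.range (B ^ n)) +
        (open Classical in if z ∈ LinearMap.range (A ^ n) then 1 else 0) := by
  have hBn : ∀ X, (B ^ n) (Submodule.Quotient.mk X) = Submodule.Quotient.mk ((A ^ n) X) := by
    induction n with
    | zero => simp
    | succ n ih => intro X; rw [pow_succ', pow_succ', Module.End.mul_apply, ih, hB]; rfl
  set P := LinearMap.range (A ^ n) with hP
  set g := (Submodule.span K {z}).mkQ.domRestrict P with hg
  have hr : LinearMap.range g = LinearMap.range (B ^ n) := by
    ext y
    constructor
    · rintro ⟨⟨x, ⟨w, rfl⟩⟩, rfl⟩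
      exact ⟨Submodule.Quotient.mk w, by rw [hBn]; rfl⟩
    · rintro ⟨w, rfl⟩
      obtain ⟨w, rfl⟩ := Submodule.Quotient.mk_surjective _ w
      exact ⟨⟨(A ^ n) w, ⟨w, rfl⟩⟩, by rw [hBn]; rfl⟩
  have h := g.finrank_range_add_finrank_ker
  rw [hr] at h
  have hk : ∀ x : P, x ∈ LinearMap.ker g ↔ ∃ c : K, c • z = (x : M) := by
    intro x
    rw [LinearMap.mem_ker, hg, LinearMap.domRestrict_apply, Submodule.mkQ_apply,
      Submodule.Quotient.mk_eq_zero, Submodule.mem_span_singleton]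
  have hker : Module.finrank K (LinearMap.ker g) =
      (open Classical in if z ∈ P then 1 else 0) := by
    split_ifs with hzP
    · have : LinearMap.ker g = Submodule.span K {(⟨z, hzP⟩ : P)} := by
        ext x
        rw [hk, Submodule.mem_span_singleton]
        simp [Subtype.ext_iff]
      rw [this, finrank_span_singleton]
      simpa [Subtype.ext_iff] using hz
    · have : LinearMap.ker g = ⊥ := by
        rw [Submodule.eq_bot_iff]
        intro x hx
        obtain ⟨c, hc⟩ := (hk x).1 hx
        by_cases h0 : c = 0
        · ext; simp [← hc, h0]
        · exact absurd ((P.smul_mem_iff h0).1 (hc ▸ x.2)) hzP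
      rw [this, finrank_bot]
  rw [hker] at h
  rw [← h]
  push_cast
  split_ifs <;> simp

lemma aux_final (z : M) (hz : z ≠ 0) (A : Module.End K M)
    (B : Module.End K (M ⧸ Submodule.span K {z}))
    (hB : ∀ X, B (Submodule.Quotient.mk X) = Submodule.Quotient.mk (A X)) (q : ℕ) (hq : 0 < q)
    (hlow : z ∈ LinearMap.range (A ^ (q - 1))) (hup : z ∉ LinearMap.range (A ^ q)) :
    (∀ d' : ℕ, 1 ≤ d' → d' ≠ q → d' ≠ q - 1 → blockMult A d' = blockMult B d') ∧
      blockMult A q = blockMult B q + 1 ∧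
      (1 < q → blockMult B (q - 1) = blockMult A (q - 1) + 1) := by
  have hmono : ∀ m n : ℕ, m ≤ n → z ∈ LinearMap.range (A ^ n) → z ∈ LinearMap.range (A ^ m) := by
    rintro m n hmn ⟨x, hx⟩
    obtain ⟨k, rfl⟩ := Nat.exists_eq_add_of_le hmn
    exact ⟨(A ^ k) x, by rw [← hx, pow_add]; rfl⟩
  have key : ∀ n, (Module.finrank K (LinearMap.range (A ^ n)) : ℤ) =
      Module.finrank K (LinearMap.range (B ^ n)) + if n < q then 1 else 0 := by
    intro n
    rw [aux_rank z hz A B hB n]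
    congr 1
    by_cases h : n < q
    · rw [if_pos h, if_pos (hmono n (q - 1) (by omega) hlow)]
    · rw [if_neg h, if_neg (fun h' => hup (hmono q n (by omega) h'))]
  refine ⟨fun d' h1 h2 h3 => ?_, ?_, fun h => ?_⟩
  all_goals
    unfold blockMult
    simp only [key]
    split_ifs <;> omega

end rankpart

section symp

variable {K V : Type*} [Field K] [CharP K 2] [AddCommGroup V] [Module K V]

lemma aux_two_end {M : Type*} [AddCommGroup M] [Module K M] (x : M) : x + x = 0 := by
  have : (2 : K) = 0 := CharTwo.two_eq_zero
  rw [← two_smul K x, this, zero_smul]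

/-- rank one operator `v ↦ b v p • p'`. -/
def rk (b : V →ₗ[K] V →ₗ[K] K) : V →ₗ[K] V →ₗ[K] Module.End K V :=
  LinearMap.mk₂ K (fun p p' => (b.flip p).smulRight p')
    (by intros; ext; simp [add_smul]) (by intros; ext; simp [mul_smul])
    (by intros; ext; simp) (by intros; ext; simp only [LinearMap.smulRight_apply, LinearMap.smul_apply]; exact smul_comm _ _ _)

lemma rk_apply (b : V →ₗ[K] V →ₗ[K] K) (p p' v : V) : rk b p p' v = b v p • p' := by
  simp [rk]

lemma aux_adj (b : V →ₗ[K] V →ₗ[K] K) (e : Module.End K V)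
    (hsp : ∀ v w : V, b (e v) w + b v (e w) = 0) (n : ℕ) (v w : V) :
    b ((e ^ n) v) w = b v ((e ^ n) w) := by
  induction n generalizing v w with
  | zero => simp
  | succ n ih =>
    rw [pow_succ, Module.End.mul_apply, ih, CharTwo.add_eq_zero.1 (hsp _ _), ← Module.End.mul_apply,
      ← pow_succ', ← pow_succ]

lemma aux_symm (b : V →ₗ[K] V →ₗ[K] K) (halt : ∀ v : V, b v v = 0) (v w : V) :
    b v w = b w v := by
  have h := halt (v + w)
  simp only [map_add, LinearMap.add_apply, halt, zero_add, add_zero] at h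
  exact (CharTwo.add_eq_zero.1 h).symm

/-- `∑ e^i X e^(q-1-i)`. -/
def Phi (e : Module.End K V) (q : ℕ) : Module.End K V →ₗ[K] Module.End K V :=
  ∑ i ∈ Finset.range q, (LinearMap.mulLeft K (e ^ i)) ∘ₗ (LinearMap.mulRight K (e ^ (q - 1 - i)))

lemma Phi_rk (b : V →ₗ[K] V →ₗ[K] K) (e : Module.End K V)
    (hsp : ∀ v w : V, b (e v) w + b v (e w) = 0) (q : ℕ) (p p' : V) :
    Phi e q (rk b p p') =
      ∑ i ∈ Finset.range q, rk b ((e ^ i) p) ((e ^ (q - 1 - i)) p') := by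
  have : Phi e q (rk b p p') =
      ∑ i ∈ Finset.range q, rk b ((e ^ (q - 1 - i)) p) ((e ^ i) p') := by
    simp only [Phi, LinearMap.sum_apply]
    refine Finset.sum_congr rfl fun i _ => ?_
    ext v
    simp only [LinearMap.comp_apply, LinearMap.mulLeft_apply, LinearMap.mulRight_apply,
      Module.End.mul_apply, rk_apply, map_smul, aux_adj b e hsp]
  rw [this, ← Finset.sum_range_reflect]
  refine Finset.sum_congr rfl fun i hi => ?_
  have := Finset.mem_range.1 hi
  congr 2
  · congr 2; omega

/-- chain sum -/
def CC (b : V →ₗ[K] V →ₗ[K] K) (e : Module.End K V) (p p' : V) (N : ℕ) : Module.End K V :=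
  ∑ j ∈ Finset.range N, rk b ((e ^ j) p) ((e ^ (N - 1 - j)) p')

/-- sparse chain sum -/
def SS (b : V →ₗ[K] V →ₗ[K] K) (e : Module.End K V) (q : ℕ) (p p' : V) (T : ℕ) :
    Module.End K V :=
  ∑ t ∈ Finset.range T, rk b ((e ^ (q * t)) p) ((e ^ (q * (T - 1 - t))) p')

lemma Phi_SS (b : V →ₗ[K] V →ₗ[K] K) (e : Module.End K V)
    (hsp : ∀ v w : V, b (e v) w + b v (e w) = 0) (q T : ℕ) (p p' : V) :
    Phi e q (SS b e q p p' T) = CC b e p p' (q * T) := by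
  rw [CC, SS, map_sum, ← aux_sum_mul]
  refine Finset.sum_congr rfl fun t ht => ?_
  rw [Phi_rk b e hsp]
  refine Finset.sum_congr rfl fun i hi => ?_
  have ht := Finset.mem_range.1 ht
  have hi := Finset.mem_range.1 hi
  rw [← Module.End.mul_apply, ← Module.End.mul_apply, ← pow_add, ← pow_add, add_comm i]
  congr 4
  obtain ⟨k, rfl⟩ := Nat.exists_eq_add_of_lt ht
  have : t + k + 1 - 1 - t = k := by omega
  rw [this, mul_add, mul_add]
  omega

lemma rk_mem (b : V →ₗ[K] V →ₗ[K] K) (halt : ∀ v : V, b v v = 0) (p p' : V) :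
    rk b p p' + rk b p' p ∈ spSub K V b := by
  intro v w
  simp only [LinearMap.add_apply, rk_apply, map_add, map_smul, LinearMap.smul_apply, smul_eq_mul]
  rw [aux_symm b halt p' w, aux_symm b halt p w]
  have h2 : (2 : K) = 0 := CharTwo.two_eq_zero
  linear_combination (b v p * b w p' + b v p' * b w p) * h2

lemma rk_mem' (b : V →ₗ[K] V →ₗ[K] K) (halt : ∀ v : V, b v v = 0) (p : V) :
    rk b p p ∈ spSub K V b := by
  intro v w
  simp only [rk_apply, map_smul, LinearMap.smul_apply, smul_eq_mul]
  rw [aux_symm b halt p w]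
  have h2 : (2 : K) = 0 := CharTwo.two_eq_zero
  linear_combination (b v p * b w p) * h2

lemma SS_flip (b : V →ₗ[K] V →ₗ[K] K) (e : Module.End K V) (q T : ℕ) (p p' : V) :
    SS b e q p p' T =
      ∑ t ∈ Finset.range T, rk b ((e ^ (q * (T - 1 - t))) p) ((e ^ (q * t)) p') := by
  rw [SS, ← Finset.sum_range_reflect]
  refine Finset.sum_congr rfl fun i hi => ?_
  have := Finset.mem_range.1 hi
  congr 2
  congr 3; omega

lemma SS_mem (b : V →ₗ[K] V →ₗ[K] K) (halt : ∀ v : V, b v v = 0) (e : Module.End K V)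
    (q T : ℕ) (p p' : V) :
    SS b e q p p' T + SS b e q p' p T ∈ spSub K V b := by
  rw [SS_flip b e q T p' p, SS, ← Finset.sum_add_distrib]
  exact Submodule.sum_mem _ fun t _ => rk_mem b halt _ _

lemma form_symm_sum (F : ℕ → ℕ → K) (hF : ∀ i j, F i j = F j i) (T : ℕ) :
    ∑ t ∈ Finset.range T, F t (T - 1 - t) = ∑ t ∈ Finset.range T, F (T - 1 - t) t :=
  Finset.sum_congr rfl fun _ _ => hF _ _

lemma SS_mem' (b : V →ₗ[K] V →ₗ[K] K) (halt : ∀ v : V, b v v = 0) (e : Module.End K V)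
    (q T : ℕ) (p : V) :
    SS b e q p p T ∈ spSub K V b := by
  intro v w
  have h1 : b (SS b e q p p T v) w = ∑ t ∈ Finset.range T,
      b v ((e ^ (q * t)) p) * b w ((e ^ (q * (T - 1 - t))) p) := by
    rw [SS]
    simp only [LinearMap.sum_apply, map_sum, rk_apply, map_smul, LinearMap.smul_apply, smul_eq_mul]
    exact Finset.sum_congr rfl fun t _ => by rw [aux_symm b halt _ w]
  have h2 : b v (SS b e q p p T w) = ∑ t ∈ Finset.range T,
      b v ((e ^ (q * t)) p) * b w ((e ^ (q * (T - 1 - t))) p) := by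
    rw [SS_flip]
    simp only [LinearMap.sum_apply, map_sum, rk_apply, map_smul, LinearMap.smul_apply, smul_eq_mul]
    exact Finset.sum_congr rfl fun t _ => by rw [mul_comm]
  rw [h1, h2, CharTwo.add_self_eq_zero]

/-- Powers of `A`. -/
lemma aux_coe_pow (b : V →ₗ[K] V →ₗ[K] K) (e : Module.End K V)
    (A : Module.End K ↥(spSub K V b))
    (hA : ∀ X : ↥(spSub K V b), (↑(A X) : Module.End K V)
        = e * (↑X : Module.End K V) - (↑X : Module.End K V) * e) (n : ℕ) (X : ↥(spSub K V b)) :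
    (((A ^ n) X : spSub K V b) : Module.End K V) =
      ((LinearMap.mulLeft K e - LinearMap.mulRight K e) ^ n) (X : Module.End K V) := by
  induction n generalizing X with
  | zero => simp
  | succ n ih =>
    rw [pow_succ, Module.End.mul_apply, ih, pow_succ, Module.End.mul_apply, hA]
    rfl

lemma aux_coe_q1 (b : V →ₗ[K] V →ₗ[K] K) (e : Module.End K V)
    (A : Module.End K ↥(spSub K V b))
    (hA : ∀ X : ↥(spSub K V b), (↑(A X) : Module.End K V)
        = e * (↑X : Module.End K V) - (↑X : Module.End K V) * e) (n : ℕ) (X : ↥(spSub K V b)) :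
    (((A ^ (2 ^ n - 1)) X : spSub K V b) : Module.End K V) = Phi e (2 ^ n) X := by
  have h2 : (2 : Module.End K (Module.End K V)) = 0 := by
    rw [← one_add_one_eq_two]; exact aux_two_end (K := K) _
  rw [aux_coe_pow b e A hA, aux_geom h2 _ _ (LinearMap.commute_mulLeft_right e e), Phi]
  simp only [LinearMap.pow_mulLeft, LinearMap.pow_mulRight]
  rfl

lemma aux_coe_q (b : V →ₗ[K] V →ₗ[K] K) (e : Module.End K V)
    (A : Module.End K ↥(spSub K V b))
    (hA : ∀ X : ↥(spSub K V b), (↑(A X) : Module.End K V)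
        = e * (↑X : Module.End K V) - (↑X : Module.End K V) * e) (n : ℕ) (X : ↥(spSub K V b)) :
    (((A ^ (2 ^ n)) X : spSub K V b) : Module.End K V) =
      e ^ (2 ^ n) * (X : Module.End K V) + (X : Module.End K V) * e ^ (2 ^ n) := by
  have h2 : (2 : Module.End K (Module.End K V)) = 0 := by
    rw [← one_add_one_eq_two]; exact aux_two_end (K := K) _
  rw [aux_coe_pow b e A hA, aux_pow2 h2 _ _ (LinearMap.commute_mulLeft_right e e)]
  simp only [LinearMap.pow_mulLeft, LinearMap.pow_mulRight]
  rfl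

/-- Obstruction. -/
lemma aux_upper (b : V →ₗ[K] V →ₗ[K] K) (e : Module.End K V)
    (hsp : ∀ v w : V, b (e v) w + b v (e w) = 0) (q : ℕ) (X : Module.End K V)
    (hX : e ^ q * X + X * e ^ q = 1) (J : ℕ) (hq : q ∣ J) (h2q : ¬ (q * 2 ∣ J)) (u w : V)
    (hu : (e ^ J) u = 0) (hw : (e ^ J) w = 0) (hbw : b ((e ^ (J - q)) u) w = 1) : False := by
  obtain ⟨s, rfl⟩ := hq
  have h2 : ∀ Y : Module.End K V, Y + Y = 0 := fun Y => aux_two_end (K := K) Y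
  have key : ∀ n : ℕ, (e ^ q) ^ (2 * n + 1) * X = X * (e ^ q) ^ (2 * n + 1) + (e ^ q) ^ (2 * n) := by
    have hc : e ^ q * X = X * e ^ q + 1 := by
      rw [← hX, add_comm, add_assoc, h2, add_zero]
    have hc2 : (e ^ q) ^ 2 * X = X * (e ^ q) ^ 2 := by
      rw [pow_two, mul_assoc, hc, mul_add, ← mul_assoc, hc, add_mul, mul_one, one_mul, add_assoc, h2,
        add_zero, mul_assoc]
    intro n
    induction n with
    | zero => simpa using hc
    | succ n ih =>
      have e1 : 2 * (n + 1) + 1 = 2 + (2 * n + 1) := by ring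
      have e2 : 2 * (n + 1) = 2 + 2 * n := by ring
      rw [e1, e2, pow_add, mul_assoc, ih, mul_add, ← mul_assoc, hc2, mul_assoc, ← pow_add, ← pow_add]
  have hs : ¬ (2 ∣ s) := fun h => h2q (Nat.mul_dvd_mul_left q h)
  obtain ⟨n, rfl⟩ : ∃ n, s = 2 * n + 1 := ⟨s / 2, by omega⟩
  have hk := congrArg (fun f : Module.End K V => b (f u) w) (key n)
  have e3 : q * (2 * n + 1) - q = q * (2 * n) := by rw [mul_add, mul_one]; omega
  rw [e3] at hbw
  simp only [← pow_mul, Module.End.mul_apply, LinearMap.add_apply, hu, map_zero, zero_add, hbw] at hk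
  rw [aux_adj b e hsp, hw, map_zero] at hk
  exact zero_ne_one hk

end symp

section blocks

variable {K V : Type*} [Field K] [CharP K 2] [AddCommGroup V] [Module K V]

lemma chain_pow (e : Module.End K V) (v : ℕ → V) (lo : ℕ) :
    ∀ (j hi : ℕ), (∀ n, lo < n → n ≤ hi → e (v n) = v (n - 1)) → lo + j ≤ hi →
      (e ^ j) (v hi) = v (hi - j) := by
  intro j
  induction j with
  | zero => simp
  | succ j ih =>
    intro hi h hle
    rw [pow_succ', Module.End.mul_apply, ih hi h (by omega), h _ (by omega) (by omega)]
    congr 1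

lemma rk_congr (b : V →ₗ[K] V →ₗ[K] K) (v : ℕ → V) {i i' j j' : ℕ} (hi : i = i') (hj : j = j') :
    rk b (v i) (v j) = rk b (v i') (v j') := by rw [hi, hj]

/-- Casimir of a block. -/
def Cas (b : V →ₗ[K] V →ₗ[K] K) (v : ℕ → V) (N : ℕ) : Module.End K V :=
  ∑ n ∈ Finset.range N, rk b (v (N - 1 - n)) (v n)

lemma cas_V (b : V →ₗ[K] V →ₗ[K] K) (e : Module.End K V) (v : ℕ → V) (d : ℕ)
    (he : ∀ n : ℕ, n < 2 * d → e (v n) = if n = 0 then 0 else v (n - 1)) :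
    CC b e (v (2 * d - 1)) (v (2 * d - 1)) (2 * d) = Cas b v (2 * d) := by
  have hp : ∀ j, j < 2 * d → (e ^ j) (v (2 * d - 1)) = v (2 * d - 1 - j) := fun j hj =>
    chain_pow e v 0 j (2 * d - 1) (fun n h1 h2 => by rw [he n (by omega), if_neg (by omega)])
      (by omega)
  rw [CC, Cas]
  refine Finset.sum_congr rfl fun n hn => ?_
  have hn := Finset.mem_range.1 hn
  rw [hp _ hn, hp _ (by omega)]
  congr 2; omega

lemma cas_W (b : V →ₗ[K] V →ₗ[K] K) (e : Module.End K V) (v : ℕ → V) (m : ℕ)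
    (he : ∀ n : ℕ, n < 2 * m → e (v n) = if n = 0 ∨ n = m then 0 else v (n - 1)) :
    CC b e (v (m - 1)) (v (2 * m - 1)) m + CC b e (v (2 * m - 1)) (v (m - 1)) m
      = Cas b v (2 * m) := by
  have hy : ∀ j, j < m → (e ^ j) (v (m - 1)) = v (m - 1 - j) := fun j hj =>
    chain_pow e v 0 j (m - 1) (fun n h1 h2 => by rw [he n (by omega), if_neg (by omega)])
      (by omega)
  have hz : ∀ j, j < m → (e ^ j) (v (2 * m - 1)) = v (2 * m - 1 - j) := fun j hj =>
    chain_pow e v m j (2 * m - 1) (fun n h1 h2 => by rw [he n (by omega), if_neg (by omega)])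
      (by omega)
  rw [CC, CC, Cas, two_mul, Finset.sum_range_add, add_comm]
  congr 1
  · refine Finset.sum_congr rfl fun n hn => ?_
    have hn := Finset.mem_range.1 hn
    rw [← two_mul, hz _ hn, hy _ (by omega)]
    congr 2; omega
  · refine Finset.sum_congr rfl fun n hn => ?_
    have hn := Finset.mem_range.1 hn
    rw [← two_mul, hy _ hn, hz _ (by omega)]
    exact rk_congr b v (by omega) (by omega)

lemma K_pow_y (e : Module.End K V) (v : ℕ → V) (l k : ℕ) (hk : 0 < k ∧ 2 * k < l)
    (he : ∀ n : ℕ, n < 2 * l → e (v n) = if n = 0 ∨ n = l then 0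
        else if n = 2 * l - k then v (n - 1) + v (k - 1) else v (n - 1))
    (i j : ℕ) (hi : i < l) (hj : j ≤ i) : (e ^ j) (v i) = v (i - j) :=
  chain_pow e v 0 j i (fun n h1 h2 => by
    rw [he n (by omega), if_neg (by omega), if_neg (by omega)]) (by omega)

lemma K_pow_y0 (e : Module.End K V) (v : ℕ → V) (l k : ℕ) (hk : 0 < k ∧ 2 * k < l)
    (he : ∀ n : ℕ, n < 2 * l → e (v n) = if n = 0 ∨ n = l then 0
        else if n = 2 * l - k then v (n - 1) + v (k - 1) else v (n - 1))
    (i j : ℕ) (hi : i < l) (hj : i < j) : (e ^ j) (v i) = 0 := by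
  obtain ⟨c, rfl⟩ : ∃ c, j = c + 1 + i := ⟨j - 1 - i, by omega⟩
  rw [pow_add, Module.End.mul_apply, K_pow_y e v l k hk he i i hi le_rfl, pow_succ,
    Module.End.mul_apply, Nat.sub_self, he 0 (by omega)]
  simp

lemma K_pow_z0 (e : Module.End K V) (v : ℕ → V) (l k : ℕ) (hk : 0 < k ∧ 2 * k < l)
    (he : ∀ n : ℕ, n < 2 * l → e (v n) = if n = 0 ∨ n = l then 0
        else if n = 2 * l - k then v (n - 1) + v (k - 1) else v (n - 1))
    (c : ℕ) (hc : c < l) : (e ^ (c + 1)) (v (l + c)) = 0 := by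
  induction c with
  | zero => simp [he l (by omega)]
  | succ c ih =>
    rw [pow_succ, Module.End.mul_apply, he _ (by omega), if_neg (by omega)]
    split_ifs with h
    · rw [map_add, K_pow_y0 e v l k hk he (k - 1) _ (by omega) (by omega), add_zero]
      exact ih (by omega)
    · exact ih (by omega)

lemma K_pow_z (e : Module.End K V) (v : ℕ → V) (l k : ℕ) (hk : 0 < k ∧ 2 * k < l)
    (he : ∀ n : ℕ, n < 2 * l → e (v n) = if n = 0 ∨ n = l then 0
        else if n = 2 * l - k then v (n - 1) + v (k - 1) else v (n - 1))
    (j : ℕ) (hj : j < l) : (e ^ j) (v (2 * l - 1)) = v (2 * l - 1 - j) +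
      if k ≤ j ∧ j < 2 * k then v (2 * k - 1 - j) else 0 := by
  induction j with
  | zero => simp [show ¬ (k ≤ 0 ∧ 0 < 2 * k) by omega]; try omega
  | succ j ih =>
    rw [pow_succ', Module.End.mul_apply, ih (by omega), map_add, he _ (by omega),
      if_neg (by omega)]
    have e1 : 2 * l - 1 - j - 1 = 2 * l - 1 - (j + 1) := by omega
    by_cases h1 : j + 1 < k
    · rw [if_neg (by omega), if_neg (by omega), if_neg (by omega), e1, map_zero]
    by_cases h2 : j + 1 = k
    · rw [if_pos (by omega), if_neg (by omega), if_pos (by omega), e1, map_zero, add_zero]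
      congr 2; omega
    rw [if_neg (by omega), e1]
    by_cases h3 : j + 1 < 2 * k
    · rw [if_pos (by omega), if_pos (by omega), he _ (by omega), if_neg (by omega),
        if_neg (by omega)]
      congr 1
    rw [if_neg (by omega : ¬ (k ≤ j + 1 ∧ j + 1 < 2 * k))]
    by_cases h4 : j < 2 * k
    · rw [if_pos (by omega), he _ (by omega), if_pos (by omega)]
    · rw [if_neg (by omega), map_zero]

lemma cas_K (b : V →ₗ[K] V →ₗ[K] K) (e : Module.End K V) (v : ℕ → V) (l k : ℕ)
    (hk : 0 < k ∧ 2 * k < l)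
    (he : ∀ n : ℕ, n < 2 * l → e (v n) = if n = 0 ∨ n = l then 0
        else if n = 2 * l - k then v (n - 1) + v (k - 1) else v (n - 1))
    (r N : ℕ) (hN : N + 2 * r + 2 * k = 2 * l) (hr : r + 2 * k ≤ l) :
    CC b e (v (l - 1)) (v (2 * l - 1)) l + CC b e (v (2 * l - 1)) (v (l - 1)) l
      + CC b e ((e ^ r) (v (l - 1))) ((e ^ r) (v (l - 1))) N = Cas b v (2 * l) := by
  have hy : ∀ j, j < l → (e ^ j) (v (l - 1)) = v (l - 1 - j) := fun j hj =>
    K_pow_y e v l k hk he (l - 1) j (by omega) (by omega)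
  have hy0 : ∀ j, l ≤ j → (e ^ j) (v (l - 1)) = 0 := fun j hj =>
    K_pow_y0 e v l k hk he (l - 1) j (by omega) (by omega)
  have hz := K_pow_z e v l k hk he
  -- the correction term
  have h3 : CC b e ((e ^ r) (v (l - 1))) ((e ^ r) (v (l - 1))) N =
      ∑ n ∈ Finset.range (2 * k), rk b (v (2 * k - 1 - n)) (v n) := by
    rw [CC]
    have hle : N = (l - 2 * k - r) + (2 * k + (l - 2 * k - r)) := by omega
    have hz1 : ∀ j ∈ Finset.range (l - 2 * k - r),
        rk b ((e ^ j) ((e ^ r) (v (l - 1)))) ((e ^ (N - 1 - j)) ((e ^ r) (v (l - 1)))) = 0 := by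
      intro j hj
      have hj := Finset.mem_range.1 hj
      rw [← Module.End.mul_apply (e ^ (N - 1 - j)), ← pow_add, hy0 (N - 1 - j + r) (by omega),
        map_zero]
    have hz2 : ∀ j ∈ Finset.range (l - 2 * k - r),
        rk b ((e ^ ((l - 2 * k - r) + (2 * k + j))) ((e ^ r) (v (l - 1))))
          ((e ^ (N - 1 - ((l - 2 * k - r) + (2 * k + j)))) ((e ^ r) (v (l - 1)))) = 0 := by
      intro j hj
      have hj := Finset.mem_range.1 hj
      rw [← Module.End.mul_apply (e ^ ((l - 2 * k - r) + (2 * k + j))), ← pow_add,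
        hy0 ((l - 2 * k - r) + (2 * k + j) + r) (by omega), map_zero, LinearMap.zero_apply]
    have : Finset.range N = Finset.range ((l - 2 * k - r) + (2 * k + (l - 2 * k - r))) := by
      rw [← hle]
    rw [this, Finset.sum_range_add, Finset.sum_range_add, Finset.sum_eq_zero hz1,
      Finset.sum_eq_zero hz2, zero_add, add_zero]
    refine Finset.sum_congr rfl fun n hn => ?_
    have hn := Finset.mem_range.1 hn
    rw [← Module.End.mul_apply, ← Module.End.mul_apply, ← pow_add, ← pow_add, hy _ (by omega),
      hy _ (by omega)]
    exact rk_congr b v (by omega) (by omega)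
  have h1 : CC b e (v (l - 1)) (v (2 * l - 1)) l =
      ∑ n ∈ Finset.range l, rk b (v (l - 1 - n)) (v (l + n)) +
      ∑ n ∈ Finset.range k, rk b (v (2 * k - 1 - n)) (v n) := by
    have : ∑ n ∈ Finset.range k, rk b (v (2 * k - 1 - n)) (v n) =
        ∑ n ∈ Finset.range l, rk b (v (l - 1 - n))
          (if k ≤ l - 1 - n ∧ l - 1 - n < 2 * k then v (2 * k - 1 - (l - 1 - n)) else 0) := by
      rw [← Finset.sum_range_reflect]
      rw [← Finset.sum_range_reflect (fun n => rk b (v (l - 1 - n)) _) l]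
      have hl : l = k + (k + (l - 2 * k)) := by omega
      have hrl : Finset.range l = Finset.range (k + (k + (l - 2 * k))) := by rw [← hl]
      rw [hrl, Finset.sum_range_add, Finset.sum_range_add]
      symm
      rw [Finset.sum_eq_zero, Finset.sum_eq_zero (s := Finset.range (l - 2 * k)), zero_add, add_zero]
      · refine Finset.sum_congr rfl fun n hn => ?_
        have hn := Finset.mem_range.1 hn
        rw [if_pos (by omega)]
        exact rk_congr b v (by omega) (by omega)
      · intro n hn
        have hn := Finset.mem_range.1 hn
        rw [if_neg (by omega), map_zero]
      · intro n hn
        have hn := Finset.mem_range.1 hn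
        rw [if_neg (by omega), map_zero]
    rw [this, CC, ← Finset.sum_add_distrib]
    refine Finset.sum_congr rfl fun n hn => ?_
    have hn := Finset.mem_range.1 hn
    rw [hy _ hn, hz _ (by omega), map_add]
    congr 3; omega
  have h2 : CC b e (v (2 * l - 1)) (v (l - 1)) l =
      ∑ n ∈ Finset.range l, rk b (v (2 * l - 1 - n)) (v n) +
      ∑ n ∈ Finset.range k, rk b (v (k - 1 - n)) (v (k + n)) := by
    have : ∑ n ∈ Finset.range k, rk b (v (k - 1 - n)) (v (k + n)) =
        ∑ n ∈ Finset.range l, rk b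
          (if k ≤ n ∧ n < 2 * k then v (2 * k - 1 - n) else 0) (v n) := by
      have hl : l = k + (k + (l - 2 * k)) := by omega
      have hrl : Finset.range l = Finset.range (k + (k + (l - 2 * k))) := by rw [← hl]
      rw [hrl, Finset.sum_range_add, Finset.sum_range_add]
      symm
      rw [Finset.sum_eq_zero, Finset.sum_eq_zero (s := Finset.range (l - 2 * k)), zero_add, add_zero]
      · refine Finset.sum_congr rfl fun n hn => ?_
        have hn := Finset.mem_range.1 hn
        rw [if_pos (by omega)]
        congr 3; omega
      · intro n hn
        have hn := Finset.mem_range.1 hn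
        rw [if_neg (by omega), map_zero, LinearMap.zero_apply]
      · intro n hn
        have hn := Finset.mem_range.1 hn
        rw [if_neg (by omega), map_zero, LinearMap.zero_apply]
    rw [this, CC, ← Finset.sum_add_distrib]
    refine Finset.sum_congr rfl fun n hn => ?_
    have hn := Finset.mem_range.1 hn
    have e1 : l - 1 - (l - 1 - n) = n := by omega
    rw [hz _ hn, hy _ (by omega), map_add, e1]
    rfl
  have h4 : ∑ n ∈ Finset.range (2 * k), rk b (v (2 * k - 1 - n)) (v n) =
      ∑ n ∈ Finset.range k, rk b (v (2 * k - 1 - n)) (v n) +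
      ∑ n ∈ Finset.range k, rk b (v (k - 1 - n)) (v (k + n)) := by
    have : Finset.range (2 * k) = Finset.range (k + k) := by rw [two_mul]
    rw [this, Finset.sum_range_add]
    congr 1
    refine Finset.sum_congr rfl fun n hn => ?_
    congr 3; omega
  have h5 : Cas b v (2 * l) = ∑ n ∈ Finset.range l, rk b (v (2 * l - 1 - n)) (v n) +
      ∑ n ∈ Finset.range l, rk b (v (l - 1 - n)) (v (l + n)) := by
    have : Finset.range (2 * l) = Finset.range (l + l) := by rw [two_mul]
    rw [Cas, this, Finset.sum_range_add]
    congr 1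
    refine Finset.sum_congr rfl fun n hn => ?_
    congr 3; omega
  rw [h3, h4, h1, h2, h5]
  generalize ∑ n ∈ Finset.range k, rk b (v (2 * k - 1 - n)) (v n) = P
  generalize ∑ n ∈ Finset.range k, rk b (v (k - 1 - n)) (v (k + n)) = Q
  have hP : P + P = 0 := aux_two_end (K := K) P
  have hQ : Q + Q = 0 := aux_two_end (K := K) Q
  generalize ∑ n ∈ Finset.range l, rk b (v (2 * l - 1 - n)) (v n) = S1
  generalize ∑ n ∈ Finset.range l, rk b (v (l - 1 - n)) (v (l + n)) = S2
  calc S2 + P + (S1 + Q) + (P + Q) = S1 + S2 + (P + P) + (Q + Q) := by abel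
    _ = S1 + S2 := by rw [hP, hQ, add_zero, add_zero]

lemma exists_rT (α l k : ℕ) (hk : 2 * k < l) (hl : 2 ^ α ∣ l) :
    ∃ r T, 2 ^ α * T + 2 * r + 2 * k = 2 * l ∧ r + 2 * k ≤ l := by
  cases α with
  | zero => exact ⟨0, 2 * l - 2 * k, by simp; omega, by omega⟩
  | succ a =>
    obtain ⟨M, rfl⟩ := hl
    have hh : 0 < 2 ^ a := by positivity
    rw [pow_succ] at *
    generalize 2 ^ a = h at *
    have hm : k % h + h * (k / h) = k := Nat.mod_add_div k h
    have hlt := Nat.mod_lt k hh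
    set c := k / h
    set s := k % h
    have hcM : c < M := by
      by_contra hcon
      have : h * M ≤ h * c := Nat.mul_le_mul_left h (by omega)
      rw [mul_assoc, mul_comm 2 M, ← mul_assoc] at hk
      omega
    obtain ⟨D, rfl⟩ := Nat.exists_eq_add_of_lt hcM
    by_cases hs : s = 0
    · refine ⟨0, 2 * (c + D + 1) - c, ?_, ?_⟩
      · have : 2 * (c + D + 1) - c = c + 2 * D + 2 := by omega
        rw [this]
        nlinarith
      · nlinarith
    · refine ⟨h - s, 2 * (c + D + 1) - (c + 1), ?_, ?_⟩
      · have : 2 * (c + D + 1) - (c + 1) = c + 2 * D + 1 := by omega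
        rw [this]
        have : (h - s) + s = h := by omega
        nlinarith
      · have : (h - s) + s = h := by omega
        have hx : h * 2 * (c + D + 1) = 2 * (h * c) + 2 * (h * D) + 2 * h := by ring
        rw [hx] at hk ⊢
        omega

lemma cas_apply (b : V →ₗ[K] V →ₗ[K] K) (v : ℕ → V) (N n : ℕ) (hn : n < N)
    (hb : ∀ n', b (v n) (v n') = if n + n' = N - 1 then 1 else 0) :
    Cas b v N (v n) = v n := by
  rw [Cas, LinearMap.sum_apply, Finset.sum_eq_single n]
  · rw [rk_apply, hb, if_pos (by omega), one_smul]
  · intro c hc hcn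
    have := Finset.mem_range.1 hc
    rw [rk_apply, hb, if_neg (by omega), zero_smul]
  · intro h; exact absurd (Finset.mem_range.2 hn) h

lemma cas_apply0 (b : V →ₗ[K] V →ₗ[K] K) (v : ℕ → V) (N : ℕ) (x : V)
    (hb : ∀ n', b x (v n') = 0) : Cas b v N x = 0 := by
  rw [Cas, LinearMap.sum_apply]
  exact Finset.sum_eq_zero fun c _ => by rw [rk_apply, hb, zero_smul]

end blocks

/-- Theorem (nilpotent case): for nilpotent `e ∈ sp(V)` with orthogonal decomposition
`V ↓ K[e] = W(m₁) ⊥ ⋯ ⊥ W(m_t) ⊥ W_{k₁}(ℓ₁) ⊥ ⋯ ⊥ W_{k_{t'}}(ℓ_{t'}) ⊥ V(2d₁) ⊥ ⋯ ⊥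
V(2d_{t''})` (encoded via families of basis vectors realizing the nilpotent models, extended
by zero beyond the block dimension), with `α` the largest integer such that
`2^α ∣ mᵢ, ℓⱼ, 2d_r` for all `i, j, r`, the Jordan block multiplicities of `ad(e)` on `sp(V)`
and on `sp(V)/Z(sp(V))` coincide in every size `d ≥ 1`, except that `sp(V)` has one more
block of size `2^α`, and (if `α > 0`) the quotient has one more block of size `2^α - 1`. -/
theorem stmt16 (K : Type*) [Field K] [IsAlgClosed K] [CharP K 2]
    (V : Type*) [AddCommGroup V] [Module K V] [FiniteDimensional K V]
    (b : V →ₗ[K] V →ₗ[K] K)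
    (halt : ∀ v : V, b v v = 0)
    (hnd : ∀ v : V, (∀ w : V, b v w = 0) → v = 0)
    (e : Module.End K V)
    (hsp : ∀ v w : V, b (e v) w + b v (e w) = 0)
    (hnil : IsNilpotent e)
    (t t' t'' : ℕ) (httt : 1 ≤ t + t' + t'')
    (m : Fin t → ℕ) (hm : ∀ i, 1 ≤ m i)
    (L : Fin t' → ℕ) (kk : Fin t' → ℕ) (hkk : ∀ j, 0 < kk j ∧ 2 * kk j < L j)
    (d : Fin t'' → ℕ) (hd : ∀ r, 1 ≤ d r)
    (vW : Fin t → ℕ → V) (vK : Fin t' → ℕ → V) (vV : Fin t'' → ℕ → V)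
    (hW0 : ∀ i, ∀ n : ℕ, 2 * m i ≤ n → vW i n = 0)
    (hK0 : ∀ j, ∀ n : ℕ, 2 * L j ≤ n → vK j n = 0)
    (hV0 : ∀ r, ∀ n : ℕ, 2 * d r ≤ n → vV r n = 0)
    (hLI : LinearIndependent K
      (Sum.elim
        (Sum.elim (fun p : Σ i : Fin t, Fin (2 * m i) => vW p.1 (p.2 : ℕ))
          (fun q : Σ j : Fin t', Fin (2 * L j) => vK q.1 (q.2 : ℕ)))
        (fun r : Σ r' : Fin t'', Fin (2 * d r') => vV r.1 (r.2 : ℕ))))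
    (hspan : Submodule.span K (Set.range
      (Sum.elim
        (Sum.elim (fun p : Σ i : Fin t, Fin (2 * m i) => vW p.1 (p.2 : ℕ))
          (fun q : Σ j : Fin t', Fin (2 * L j) => vK q.1 (q.2 : ℕ)))
        (fun r : Σ r' : Fin t'', Fin (2 * d r') => vV r.1 (r.2 : ℕ)))) = ⊤)
    (hbWW : ∀ i i' : Fin t, ∀ n n' : ℕ,
      b (vW i n) (vW i' n') = if i = i' ∧ n + n' = 2 * m i - 1 then 1 else 0)
    (hbKK : ∀ j j' : Fin t', ∀ n n' : ℕ,
      b (vK j n) (vK j' n') = if j = j' ∧ n + n' = 2 * L j - 1 then 1 else 0)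
    (hbVV : ∀ r r' : Fin t'', ∀ n n' : ℕ,
      b (vV r n) (vV r' n') = if r = r' ∧ n + n' = 2 * d r - 1 then 1 else 0)
    (hbWK : ∀ (i : Fin t) (j : Fin t') (n n' : ℕ), b (vW i n) (vK j n') = 0)
    (hbKW : ∀ (j : Fin t') (i : Fin t) (n n' : ℕ), b (vK j n) (vW i n') = 0)
    (hbWV : ∀ (i : Fin t) (r : Fin t'') (n n' : ℕ), b (vW i n) (vV r n') = 0)
    (hbVW : ∀ (r : Fin t'') (i : Fin t) (n n' : ℕ), b (vV r n) (vW i n') = 0)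
    (hbKV : ∀ (j : Fin t') (r : Fin t'') (n n' : ℕ), b (vK j n) (vV r n') = 0)
    (hbVK : ∀ (r : Fin t'') (j : Fin t') (n n' : ℕ), b (vV r n) (vK j n') = 0)
    (heW : ∀ i, ∀ n : ℕ, n < 2 * m i →
      e (vW i n) = if n = 0 ∨ n = m i then 0 else vW i (n - 1))
    (heK : ∀ j, ∀ n : ℕ, n < 2 * L j →
      e (vK j n) =
        if n = 0 ∨ n = L j then 0
        else if n = 2 * L j - kk j then vK j (n - 1) + vK j (kk j - 1)
        else vK j (n - 1))
    (heV : ∀ r, ∀ n : ℕ, n < 2 * d r →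
      e (vV r n) = if n = 0 then 0 else vV r (n - 1))
    (α : ℕ)
    (hα1 : ∀ i, 2 ^ α ∣ m i) (hα2 : ∀ j, 2 ^ α ∣ L j) (hα3 : ∀ r, 2 ^ α ∣ 2 * d r)
    (hα4 : ¬ ((∀ i, 2 ^ (α + 1) ∣ m i) ∧ (∀ j, 2 ^ (α + 1) ∣ L j) ∧
      (∀ r, 2 ^ (α + 1) ∣ 2 * d r)))
    (h1 : (1 : Module.End K V) ∈ spSub K V b)
    (A : Module.End K ↥(spSub K V b))
    (hA : ∀ X : ↥(spSub K V b),
      (↑(A X) : Module.End K V)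
        = e * (↑X : Module.End K V) - (↑X : Module.End K V) * e)
    (B : Module.End K
      (↥(spSub K V b) ⧸ Submodule.span K {(⟨1, h1⟩ : ↥(spSub K V b))}))
    (hB : ∀ X : ↥(spSub K V b),
      B (Submodule.Quotient.mk X) = Submodule.Quotient.mk (A X)) :
    (∀ d' : ℕ, 1 ≤ d' → d' ≠ 2 ^ α → d' ≠ 2 ^ α - 1 →
        blockMult A d' = blockMult B d') ∧
      blockMult A (2 ^ α) = blockMult B (2 ^ α) + 1 ∧
      (0 < α → blockMult B (2 ^ α - 1) = blockMult A (2 ^ α - 1) + 1) := by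
  classical
  have hq : 0 < 2 ^ α := by positivity
  -- upper bound
  have hup : ∀ X : ↥(spSub K V b), (A ^ (2 ^ α)) X ≠ ⟨1, h1⟩ := by
    intro X hX
    have hX' := congrArg (fun Y : ↥(spSub K V b) => (Y : Module.End K V)) hX
    simp only [aux_coe_q b e A hA] at hX'
    apply hα4
    rw [pow_succ]
    refine ⟨fun i => ?_, fun j => ?_, fun r => ?_⟩
    · by_contra hc
      have hle := Nat.le_of_dvd (hm i) (hα1 i)
      have hmi := hm i
      have hy : ∀ j, j < m i → (e ^ j) (vW i (m i - 1)) = vW i (m i - 1 - j) := fun j hj =>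
        chain_pow e (vW i) 0 j (m i - 1)
          (fun n h1 h2 => by rw [heW i n (by omega), if_neg (by omega)]) (by omega)
      have hz : ∀ c, c < m i → (e ^ c) (vW i (m i + c)) = vW i (m i) := fun c hc => by
        rw [chain_pow e (vW i) (m i) c (m i + c)
          (fun n h1 h2 => by rw [heW i n (by omega), if_neg (by omega)]) (by omega)]
        congr 1; omega
      refine aux_upper b e hsp _ X hX' (m i) (hα1 i) hc (vW i (m i - 1))
        (vW i (m i + (m i - 2 ^ α))) ?_ ?_ ?_
      · obtain ⟨c, hc⟩ : ∃ c, m i = 1 + c := ⟨m i - 1, by omega⟩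
        have : e ^ (m i) = e ^ 1 * e ^ (m i - 1) := by rw [← pow_add]; congr 1; omega
        rw [this, Module.End.mul_apply, hy _ (by omega), Nat.sub_self, pow_one,
          heW i 0 (by omega), if_pos (by omega)]
      · have : e ^ (m i) = e ^ (2 ^ α - 1) * (e ^ 1 * e ^ (m i - 2 ^ α)) := by
          rw [← pow_add, ← pow_add]; congr 1; omega
        rw [this, Module.End.mul_apply, Module.End.mul_apply, hz _ (by omega), pow_one,
          heW i _ (by omega), if_pos (by omega), map_zero]
      · rw [hy _ (by omega), hbWW, if_pos ⟨rfl, by omega⟩]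
    · by_contra hc
      have hkj := hkk j
      have hle := Nat.le_of_dvd (by omega) (hα2 j)
      refine aux_upper b e hsp _ X hX' (L j) (hα2 j) hc (vK j (L j - 1))
        (vK j (L j + (L j - 2 ^ α))) ?_ ?_ ?_
      · exact K_pow_y0 e (vK j) _ _ hkj (heK j) _ _ (by omega) (by omega)
      · have : e ^ (L j) = e ^ (2 ^ α - 1) * e ^ (L j - 2 ^ α + 1) := by
          rw [← pow_add]; congr 1; omega
        rw [this, Module.End.mul_apply,
          K_pow_z0 e (vK j) _ _ hkj (heK j) _ (by omega), map_zero]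
      · rw [K_pow_y e (vK j) _ _ hkj (heK j) _ _ (by omega) (by omega), hbKK,
          if_pos ⟨rfl, by omega⟩]
    · by_contra hc
      have hdr := hd r
      have hle := Nat.le_of_dvd (by omega) (hα3 r)
      have hz : ∀ j n, n < 2 * d r → j ≤ n → (e ^ j) (vV r n) = vV r (n - j) := fun j n hn hj =>
        chain_pow e (vV r) 0 j n
          (fun n h1 h2 => by rw [heV r n (by omega), if_neg (by omega)]) (by omega)
      have hz0 : ∀ n, n < 2 * d r → (e ^ (2 * d r)) (vV r n) = 0 := by
        intro n hn
        have : e ^ (2 * d r) = e ^ (2 * d r - 1 - n) * (e ^ 1 * e ^ n) := by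
          rw [← pow_add, ← pow_add]; congr 1; omega
        rw [this, Module.End.mul_apply, Module.End.mul_apply, hz _ _ hn le_rfl, Nat.sub_self,
          pow_one, heV r 0 (by omega), if_pos rfl, map_zero]
      refine aux_upper b e hsp _ X hX' (2 * d r) (hα3 r) hc (vV r (2 * d r - 1))
        (vV r (2 * d r - 2 ^ α)) (hz0 _ (by omega)) (hz0 _ (by omega)) ?_
      rw [hz _ _ (by omega) (by omega), hbVV, if_pos ⟨rfl, by omega⟩]
  -- nonzero
  have hne : (⟨1, h1⟩ : ↥(spSub K V b)) ≠ 0 := fun h => hup 0 (by rw [map_zero, h])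
  -- lower bound
  have hlow : (⟨1, h1⟩ : ↥(spSub K V b)) ∈ LinearMap.range (A ^ (2 ^ α - 1)) := by
    choose TW hTW using hα1
    choose TV hTV using hα3
    have hKK := fun j => exists_rT α (L j) (kk j) (hkk j).2 (hα2 j)
    choose rK TT hTT1 hTT2 using hKK
    choose TK hTK using hα2
    set yW := fun i => vW i (m i - 1)
    set zW := fun i => vW i (2 * m i - 1)
    set yK := fun j => vK j (L j - 1)
    set zK := fun j => vK j (2 * L j - 1)
    set zV := fun r => vV r (2 * d r - 1)
    set q := 2 ^ α with hqdef
    set X : Module.End K V :=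
      ∑ i, (SS b e q (yW i) (zW i) (TW i) + SS b e q (zW i) (yW i) (TW i)) +
      ∑ j, (SS b e q (yK j) (zK j) (TK j) + SS b e q (zK j) (yK j) (TK j)
        + SS b e q ((e ^ rK j) (yK j)) ((e ^ rK j) (yK j)) (TT j)) +
      ∑ r, SS b e q (zV r) (zV r) (TV r) with hXdef
    have hXmem : X ∈ spSub K V b := by
      refine Submodule.add_mem _ (Submodule.add_mem _ ?_ ?_) ?_
      · exact Submodule.sum_mem _ fun i _ => SS_mem b halt e q _ _ _
      · exact Submodule.sum_mem _ fun i _ =>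
          Submodule.add_mem _ (SS_mem b halt e q _ _ _) (SS_mem' b halt e q _ _)
      · exact Submodule.sum_mem _ fun i _ => SS_mem' b halt e q _ _
    refine ⟨⟨X, hXmem⟩, Subtype.ext ?_⟩
    rw [aux_coe_q1 b e A hA, ← hqdef]
    have hPhi : Phi e q X = ∑ i, Cas b (vW i) (2 * m i) + ∑ j, Cas b (vK j) (2 * L j)
        + ∑ r, Cas b (vV r) (2 * d r) := by
      rw [hXdef, map_add, map_add, map_sum, map_sum, map_sum]
      congr 1
      · congr 1
        · refine Finset.sum_congr rfl fun i _ => ?_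
          rw [map_add, Phi_SS b e hsp, Phi_SS b e hsp, ← hTW, cas_W b e (vW i) (m i) (heW i)]
        · refine Finset.sum_congr rfl fun j _ => ?_
          rw [map_add, map_add, Phi_SS b e hsp, Phi_SS b e hsp, Phi_SS b e hsp, ← hTK]
          exact cas_K b e (vK j) (L j) (kk j) (hkk j) (heK j) (rK j) _ (hTT1 j) (hTT2 j)
      · refine Finset.sum_congr rfl fun r _ => ?_
        rw [Phi_SS b e hsp, ← hTV, cas_V b e (vV r) (d r) (heV r)]
    rw [hPhi]
    refine LinearMap.ext_on_range hspan ?_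
    rintro ((⟨i, n, hn⟩ | ⟨j, n, hn⟩) | ⟨r, n, hn⟩)
    · simp only [Sum.elim_inl, LinearMap.add_apply, LinearMap.sum_apply, Module.End.one_apply]
      rw [Finset.sum_eq_single i, Finset.sum_eq_zero, Finset.sum_eq_zero, add_zero, add_zero]
      · exact cas_apply b (vW i) _ n hn fun n' => by rw [hbWW]; simp
      · intro r _; exact cas_apply0 b _ _ _ fun n' => hbWV _ _ _ _
      · intro r _; exact cas_apply0 b _ _ _ fun n' => hbWK _ _ _ _
      · intro i' _ hi'
        exact cas_apply0 b _ _ _ fun n' => by rw [hbWW, if_neg (fun h => hi' h.1.symm)]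
      · intro h; exact absurd (Finset.mem_univ i) h
    · simp only [Sum.elim_inl, Sum.elim_inr, LinearMap.add_apply, LinearMap.sum_apply,
        Module.End.one_apply]
      rw [Finset.sum_eq_zero, Finset.sum_eq_single j, Finset.sum_eq_zero, add_zero, zero_add]
      · exact cas_apply b (vK j) _ n hn fun n' => by rw [hbKK]; simp
      · intro r _; exact cas_apply0 b _ _ _ fun n' => hbKV _ _ _ _
      · intro i' _ hi'
        exact cas_apply0 b _ _ _ fun n' => by rw [hbKK, if_neg (fun h => hi' h.1.symm)]
      · intro h; exact absurd (Finset.mem_univ j) h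
      · intro r _; exact cas_apply0 b _ _ _ fun n' => hbKW _ _ _ _
    · simp only [Sum.elim_inr, LinearMap.add_apply, LinearMap.sum_apply, Module.End.one_apply]
      rw [Finset.sum_eq_zero, Finset.sum_eq_zero, Finset.sum_eq_single r, zero_add, zero_add]
      · exact cas_apply b (vV r) _ n hn fun n' => by rw [hbVV]; simp
      · intro i' _ hi'
        exact cas_apply0 b _ _ _ fun n' => by rw [hbVV, if_neg (fun h => hi' h.1.symm)]
      · intro h; exact absurd (Finset.mem_univ r) h
      · intro r _; exact cas_apply0 b _ _ _ fun n' => hbVK _ _ _ _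
      · intro r _; exact cas_apply0 b _ _ _ fun n' => hbVW _ _ _ _
  obtain ⟨f1, f2, f3⟩ := aux_final _ hne A B hB (2 ^ α) hq hlow
    (by rintro ⟨X, hX⟩; exact hup X hX)
  exact ⟨f1, f2, fun h => f3 (Nat.one_lt_two_pow (by omega))⟩
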